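/- arXiv:0706.3973 — 10 statements merged into one kernel-verified Lean document; each statement's English description precedes it below -/
import Mathlib

section
/- Let p : E → B be a fibration, let f, g : X → B be continuous maps and let H : X × [0,1] → B be a homotopy from f to g. Then for every lifting solution H' for H, the associated fiber transport ω_{H'} : f*E → g*E is a fiber homotopy equivalence over X, and the composition ḡ ∘ ω_{H'} : f*E → E is homotopic to f̄ : f*E → E. -/
open unitInterval

/-- A map `p : E → B` is a fibration if it has the homotopy lifting property
with respect to all topological spaces. -/
def IsFibration {E B : Type} [TopologicalSpace E] [TopologicalSpace B] (p : E → B) : Prop :=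
  ∀ (A : Type) (_ : TopologicalSpace A) (g : A → E) (G : A × I → B),
    Continuous g → Continuous G → (∀ a, G (a, 0) = p (g a)) →
      ∃ G' : A × I → E, Continuous G' ∧ (∀ a, G' (a, 0) = g a) ∧ ∀ x, p (G' x) = G x

/-- Two maps are homotopic. -/
def HomotopicMaps {A B : Type} [TopologicalSpace A] [TopologicalSpace B] (f g : A → B) : Prop :=
  ∃ H : A × I → B, Continuous H ∧ (∀ a, H (a, 0) = f a) ∧ ∀ a, H (a, 1) = g a

/-- A map is a homotopy equivalence. -/
def IsHomotopyEquiv {A B : Type} [TopologicalSpace A] [TopologicalSpace B] (u : A → B) : Prop :=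
  Continuous u ∧ ∃ v : B → A, Continuous v ∧
    HomotopicMaps (fun a => v (u a)) id ∧ HomotopicMaps (fun b => u (v b)) id

/-- Two maps `u v : D → D'` over `X` (with reference maps `q : D → X`, `q' : D' → X`)
are fiber homotopic over `X`. -/
def FiberHomotopic {D D' X : Type} [TopologicalSpace D] [TopologicalSpace D']
    [TopologicalSpace X] (q : D → X) (q' : D' → X) (u v : D → D') : Prop :=
  ∃ L : D × I → D', Continuous L ∧ (∀ d, L (d, 0) = u d) ∧ (∀ d, L (d, 1) = v d) ∧
    ∀ d t, q' (L (d, t)) = q d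

/-- A map `u : D → D'` over `X` is a fiber homotopy equivalence over `X`. -/
def IsFiberHomotopyEquiv {D D' X : Type} [TopologicalSpace D] [TopologicalSpace D']
    [TopologicalSpace X] (q : D → X) (q' : D' → X) (u : D → D') : Prop :=
  Continuous u ∧ (∀ d, q' (u d) = q d) ∧
    ∃ v : D' → D, Continuous v ∧ (∀ d', q (v d') = q' d') ∧
      FiberHomotopic q q (fun d => v (u d)) id ∧ FiberHomotopic q' q' (fun d' => u (v d')) id

theorem FiberHomotopic.symm {D D' X : Type} [TopologicalSpace D] [TopologicalSpace D']
    [TopologicalSpace X] {q : D → X} {q' : D' → X} {u v : D → D'}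
    (h : FiberHomotopic q q' u v) : FiberHomotopic q q' v u := by
  obtain ⟨L, hL, h0, h1, hq⟩ := h
  exact ⟨fun x => L (x.1, σ x.2), by fun_prop, by simp [h1], by simp [h0], fun d t => hq d (σ t)⟩

/-- Concatenation of two homotopies parametrized by the right factor `I`. -/
theorem exists_concat {D E : Type} [TopologicalSpace D] [TopologicalSpace E]
    {L M : D × I → E} (hL : Continuous L) (hM : Continuous M) (h : ∀ d, L (d, 1) = M (d, 0)) :
    ∃ N : D × I → E, Continuous N ∧
      (∀ d (t : I) (ht : (t : ℝ) ≤ 1 / 2),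
        N (d, t) = L (d, ⟨2 * t, (mul_pos_mem_iff zero_lt_two).2 ⟨t.2.1, ht⟩⟩)) ∧
      ∀ d (t : I) (ht : 1 / 2 ≤ (t : ℝ)),
        N (d, t) = M (d, ⟨2 * t - 1, two_mul_sub_one_mem_iff.2 ⟨ht, t.2.2⟩⟩) := by
  have hproj : Continuous (Set.projIcc (0 : ℝ) 1 zero_le_one) := continuous_projIcc
  refine ⟨fun x => if (x.2 : ℝ) ≤ 1 / 2 then L (x.1, Set.projIcc 0 1 zero_le_one (2 * x.2))
    else M (x.1, Set.projIcc 0 1 zero_le_one (2 * x.2 - 1)), ?_, ?_, ?_⟩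
  · refine Continuous.if_le (by fun_prop) (by fun_prop) (by fun_prop) (by fun_prop) ?_
    rintro ⟨d, t⟩ ht
    simp only at ht
    simp [ht, h]
  · intro d t ht
    simp only [ht, if_true]
    rw [Set.projIcc_of_mem]
  · intro d t ht
    rcases ht.eq_or_lt with ht' | ht'
    · simp [← ht', h]
    · simp only [not_le.2 ht', if_false]
      rw [Set.projIcc_of_mem]

theorem FiberHomotopic.trans {D D' X : Type} [TopologicalSpace D] [TopologicalSpace D']
    [TopologicalSpace X] {q : D → X} {q' : D' → X} {u v w : D → D'}
    (h : FiberHomotopic q q' u v) (h' : FiberHomotopic q q' v w) : FiberHomotopic q q' u w := by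
  obtain ⟨L, hL, hL0, hL1, hLq⟩ := h
  obtain ⟨M, hM, hM0, hM1, hMq⟩ := h'
  obtain ⟨N, hN, hNL, hNM⟩ := exists_concat hL hM fun d => (hL1 d).trans (hM0 d).symm
  refine ⟨N, hN, fun d => ?_, fun d => ?_, fun d t => ?_⟩
  · rw [hNL d 0 (by norm_num), ← hL0]
    congr 2
    ext
    simp
  · rw [hNM d 1 (by norm_num), ← hM1]
    congr 2
    ext
    norm_num
  · rcases le_total (t : ℝ) (1 / 2) with ht | ht
    · rw [hNL d t ht, hLq]
    · rw [hNM d t ht, hMq]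

/-- If a homotopy in `E` lies over a family of paths in `B` run along a loop `τ` of the interval,
then its ends are homotopic by a vertical homotopy. -/
theorem IsFibration.fiberHomotopic_of_loop {E B D : Type} [TopologicalSpace E]
    [TopologicalSpace B] [TopologicalSpace D] {p : E → B} (hp : IsFibration p)
    {Γ : D × I → B} (hΓ : Continuous Γ) {τ : I → I} (hτ : Continuous τ)
    (hτ0 : τ 0 = 0) (hτ1 : τ 1 = 0) {c : D × I → E} (hc : Continuous c)
    (hcΓ : ∀ d s, p (c (d, s)) = Γ (d, τ s)) :
    FiberHomotopic (fun d => Γ (d, 0)) p (fun d => c (d, 0)) (fun d => c (d, 1)) := by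
  obtain ⟨Θ, hΘ, hΘ0, hΘp⟩ := hp (D × I) inferInstance c
    (fun x => Γ (x.1.1, τ x.1.2 * σ x.2)) hc (by fun_prop) (by simp [hcΓ])
  have side (s : I) (hs : τ s = 0) :
      FiberHomotopic (fun d => Γ (d, 0)) p (fun d => c (d, s)) (fun d => Θ ((d, s), 1)) :=
    ⟨fun x => Θ ((x.1, s), x.2), by fun_prop, by simp [hΘ0], by simp, by simp [hΘp, hs]⟩
  have top : FiberHomotopic (fun d => Γ (d, 0)) p (fun d => Θ ((d, 0), 1))
      (fun d => Θ ((d, 1), 1)) :=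
    ⟨fun x => Θ (x, 1), by fun_prop, by simp, by simp, by simp [hΘp]⟩
  exact ((side 0 hτ0).trans top).trans (side 1 hτ1).symm

/-- Transport along a homotopy followed by transport along the reversed homotopy is
fiber homotopic to the identity. -/
theorem IsFibration.fiberHomotopic_transport_symm_comp
    {E B X : Type} [TopologicalSpace E] [TopologicalSpace B] [TopologicalSpace X]
    {p : E → B} (hp : IsFibration p) {f g : X → B}
    {H : X × I → B} (hH : Continuous H) (hH0 : ∀ x, H (x, 0) = f x)
    {H' : {xe : X × E // f xe.1 = p xe.2} × I → E} (hH'c : Continuous H')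
    (hH'0 : ∀ z, H' (z, 0) = z.1.2) (hH'p : ∀ z t, p (H' (z, t)) = H (z.1.1, t))
    {K' : {xe : X × E // g xe.1 = p xe.2} × I → E} (hK'c : Continuous K')
    (hK'0 : ∀ z, K' (z, 0) = z.1.2) (hK'p : ∀ z t, p (K' (z, t)) = H (z.1.1, σ t))
    {ω : {xe : X × E // f xe.1 = p xe.2} → {xe : X × E // g xe.1 = p xe.2}}
    (hωc : Continuous ω) (hω : ∀ z, (ω z).1 = (z.1.1, H' (z, 1)))
    {v : {xe : X × E // g xe.1 = p xe.2} → {xe : X × E // f xe.1 = p xe.2}}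
    (hv : ∀ z, (v z).1 = (z.1.1, K' (z, 1))) :
    FiberHomotopic (fun z : {xe : X × E // f xe.1 = p xe.2} => z.1.1) (fun z => z.1.1)
      (fun z => v (ω z)) id := by
  obtain ⟨c, hc, hcK, hcH⟩ := exists_concat
    (L := fun x => K' (ω x.1, σ x.2)) (M := fun x => H' (x.1, σ x.2))
    (by fun_prop) (by fun_prop) (by simp [hK'0, hω])
  have hτ : Continuous fun s : I =>
      Set.projIcc (0 : ℝ) 1 zero_le_one (min (2 * s) (2 - 2 * s)) :=
    continuous_projIcc.comp (by fun_prop)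
  obtain ⟨L, hL, hL0, hL1, hLp⟩ := hp.fiberHomotopic_of_loop
    (Γ := fun x : {xe : X × E // f xe.1 = p xe.2} × I => H (x.1.1.1, x.2))
    (by fun_prop) hτ (by simp) (by simp) hc (by
      intro z s
      rcases le_total (s : ℝ) (1 / 2) with hs | hs
      · rw [hcK z s hs]
        simp only [hK'p, hω, unitInterval.symm_symm]
        congr 2
        rw [min_eq_left (by linarith), Set.projIcc_of_mem]
      · rw [hcH z s hs]
        simp only [hH'p]
        congr 2
        rw [min_eq_right (by linarith), Set.projIcc_of_mem _ ⟨by linarith [s.2.2], by linarith⟩]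
        ext
        simp only [coe_symm_eq]
        ring)
  refine ⟨fun x => ⟨(x.1.1.1, L x), (hH0 _).symm.trans (hLp x.1 x.2).symm⟩, by fun_prop, fun z => ?_,
    fun z => ?_, fun _ _ => rfl⟩
  · apply Subtype.ext
    simp only [hv, hω, hL0]
    rw [hcK z 0 (by norm_num)]
    simp
  · apply Subtype.ext
    have h1 : (⟨2 * ((1 : I) : ℝ) - 1,
        two_mul_sub_one_mem_iff.2 ⟨by norm_num, by simp⟩⟩ : I) = 1 := by
      ext
      norm_num
    simp only [hL1, id]
    rw [hcH z 1 (by norm_num), h1]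
    simp [hH'0]

/-- Given a fibration `p : E → B`, a homotopy `H` from `f` to `g`, and any
lifting solution `H'` for `H`, the associated fiber transport `ω : f*E → g*E` is a fiber
homotopy equivalence over `X`, and `ḡ ∘ ω` is homotopic to `f̄`. -/
theorem fiber_transport_is_fiber_homotopy_equiv
    {E B X : Type} [TopologicalSpace E] [TopologicalSpace B] [TopologicalSpace X]
    (p : E → B) (hpc : Continuous p) (hp : IsFibration p)
    (f g : X → B) (hf : Continuous f) (hg : Continuous g)
    (H : X × I → B) (hH : Continuous H)
    (hH0 : ∀ x, H (x, 0) = f x) (hH1 : ∀ x, H (x, 1) = g x)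
    (H' : {xe : X × E // f xe.1 = p xe.2} × I → E)
    (hH'c : Continuous H')
    (hH'0 : ∀ z, H' (z, 0) = z.1.2)
    (hH'p : ∀ z t, p (H' (z, t)) = H (z.1.1, t))
    (ω : {xe : X × E // f xe.1 = p xe.2} → {xe : X × E // g xe.1 = p xe.2})
    (hω : ∀ z, (ω z).1 = (z.1.1, H' (z, 1))) :
    IsFiberHomotopyEquiv (fun z => z.1.1) (fun z => z.1.1) ω ∧
      HomotopicMaps (fun z => (ω z).1.2) (fun z => z.1.2) := by
  have hωc : Continuous ω := by
    refine continuous_induced_rng.2 ?_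
    simp only [Function.comp_def, hω]
    fun_prop
  obtain ⟨K', hK'c, hK'0, hK'p⟩ := hp {xe : X × E // g xe.1 = p xe.2} inferInstance
    (fun z => z.1.2) (fun x => H (x.1.1.1, σ x.2)) (by fun_prop) (by fun_prop)
    (fun z => by simp [hH1, z.2])
  let v (z : {xe : X × E // g xe.1 = p xe.2}) : {xe : X × E // f xe.1 = p xe.2} :=
    ⟨(z.1.1, K' (z, 1)), by simp [hK'p, hH0]⟩
  have hvc : Continuous v := by fun_prop
  have hv (z) : (v z).1 = (z.1.1, K' (z, 1)) := rfl
  refine ⟨⟨hωc, fun z => by simp [hω], v, hvc, fun _ => rfl, ?_, ?_⟩, ?_⟩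
  · exact hp.fiberHomotopic_transport_symm_comp hH hH0 hH'c hH'0 hH'p hK'c hK'0
      (fun z t => hK'p (z, t)) hωc hω hv
  · exact hp.fiberHomotopic_transport_symm_comp (H := fun x => H (x.1, σ x.2)) (by fun_prop)
      (by simp [hH1]) hK'c hK'0 (fun z t => hK'p (z, t)) hH'c hH'0 (by simp [hH'p])
      hvc hv hω
  · exact ⟨fun x => H' (x.1, σ x.2), by fun_prop, by simp [hω], by simp [hH'0]⟩
end

section
/- Let p : E → B be a fibration, let f, g : X → B be continuous maps, and let H, K : X × [0,1] → B be homotopies from f to g that are homotopic relative to X × {0,1}, i.e. there is a continuous L : X × [0,1] × [0,1] → B with L(x,t,0) = H(x,t), L(x,t,1) = K(x,t), L(x,0,s) = f(x) and L(x,1,s) = g(x) for all x, t, s. Then for every lifting solution H' for H and every lifting solution K' for K, the fiber transports ω_{H'} and ω_{K'} : f*E → g*E are fiber homotopic over X. -/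
open unitInterval

/-- If `H` and `K` are homotopies from `f` to `g` that are homotopic relative to
`X × {0,1}`, then the fiber transports associated to any lifting solutions for `H` and for `K`
are fiber homotopic over `X`. -/
theorem fiber_transports_of_rel_homotopic_homotopies_fiberHomotopic
    {E B X : Type} [TopologicalSpace E] [TopologicalSpace B] [TopologicalSpace X]
    (p : E → B) (hpc : Continuous p) (hp : IsFibration p)
    (f g : X → B) (hf : Continuous f) (hg : Continuous g)
    (H K : X × I → B) (hH : Continuous H) (hK : Continuous K)
    (hH0 : ∀ x, H (x, 0) = f x) (hH1 : ∀ x, H (x, 1) = g x)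
    (hK0 : ∀ x, K (x, 0) = f x) (hK1 : ∀ x, K (x, 1) = g x)
    (L : X × I × I → B) (hL : Continuous L)
    (hLH : ∀ x t, L (x, t, 0) = H (x, t)) (hLK : ∀ x t, L (x, t, 1) = K (x, t))
    (hLf : ∀ x s, L (x, 0, s) = f x) (hLg : ∀ x s, L (x, 1, s) = g x)
    (H' : {xe : X × E // f xe.1 = p xe.2} × I → E)
    (hH'c : Continuous H')
    (hH'0 : ∀ z, H' (z, 0) = z.1.2)
    (hH'p : ∀ z t, p (H' (z, t)) = H (z.1.1, t))
    (K' : {xe : X × E // f xe.1 = p xe.2} × I → E)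
    (hK'c : Continuous K')
    (hK'0 : ∀ z, K' (z, 0) = z.1.2)
    (hK'p : ∀ z t, p (K' (z, t)) = K (z.1.1, t))
    (ω ω' : {xe : X × E // f xe.1 = p xe.2} → {xe : X × E // g xe.1 = p xe.2})
    (hω : ∀ z, (ω z).1 = (z.1.1, H' (z, 1)))
    (hω' : ∀ z, (ω' z).1 = (z.1.1, K' (z, 1))) :
    FiberHomotopic (fun z => z.1.1) (fun z => z.1.1) ω ω' := by
  let c : ℝ → I := Set.projIcc 0 1 zero_le_one
  have hc : Continuous c := continuous_projIcc
  have c0 {r : ℝ} (h : r ≤ 0) : c r = 0 := Set.projIcc_of_le_left _ h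
  have c1 {r : ℝ} (h : 1 ≤ r) : c r = 1 := Set.projIcc_of_right_le _ h
  -- Lift the path in the square that runs along the three sides `s = 0`, `t = 0`, `s = 1`.
  let γ : {xe : X × E // f xe.1 = p xe.2} × I → E := fun a =>
    if (a.2 : ℝ) ≤ 1 / 2 then H' (a.1, c (1 - 3 * a.2)) else K' (a.1, c (3 * a.2 - 2))
  have hγ : Continuous γ := by
    refine Continuous.if_le (by fun_prop) (by fun_prop) (by fun_prop) (by fun_prop) ?_
    intro a ha
    rw [c0 (by linarith), c0 (by linarith), hH'0, hK'0]
  -- Push that path to the side `t = 1`, keeping its endpoints fixed.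
  let G : ({xe : X × E // f xe.1 = p xe.2} × I) × I → B := fun b =>
    L (b.1.1.1.1, c (max (1 - 3 * (b.1.2 : ℝ)) (3 * (b.1.2 : ℝ) - 2) + 2 * b.2), c (3 * b.1.2 - 1))
  have hG : Continuous G := by fun_prop
  have hGγ (a) : G (a, 0) = p (γ a) := by
    obtain ⟨z, s⟩ := a
    simp only [G, γ, Set.Icc.coe_zero, mul_zero, add_zero]
    split_ifs with h
    · rw [max_eq_left (by linarith), hH'p]
      rcases le_total (s : ℝ) (1 / 3) with h' | h'
      · rw [c0 (r := 3 * s - 1) (by linarith), hLH]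
      · rw [c0 (r := 1 - 3 * s) (by linarith), hLf, hH0]
    · push Not at h
      rw [max_eq_right (by linarith), hK'p]
      rcases le_total (s : ℝ) (2 / 3) with h' | h'
      · rw [c0 (r := 3 * s - 2) (by linarith), hLf, hK0]
      · rw [c1 (r := 3 * s - 1) (by linarith), hLK]
  obtain ⟨G', hG'c, hG'0, hG'p⟩ := hp _ inferInstance γ G hγ hG hGγ
  -- Restrict the lift to the other three sides of its parameter square, which lie over `g`.
  let M : {xe : X × E // f xe.1 = p xe.2} × I → E := fun a =>
    G' ((a.1, c (3 * a.2 - 1)), c (min (3 * a.2) (3 - 3 * a.2)))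
  have hM : Continuous M := by fun_prop
  have hpM (z r) : g z.1.1 = p (M (z, r)) := by
    simp only [M, hG'p, G]
    rw [c1 (r := max _ _ + _), hLg]
    rcases le_total (r : ℝ) (1 / 3) with h | h
    · rw [c0 (r := 3 * r - 1) (by linarith)]
      refine le_add_of_le_of_nonneg (le_max_of_le_left ?_)
        (mul_nonneg zero_le_two (c _).2.1)
      simp
    rcases le_total (r : ℝ) (2 / 3) with h' | h'
    · rw [c1 (r := min _ _) (le_min (by linarith) (by linarith))]
      have hs := le_max_left (1 - 3 * (c (3 * r - 1) : ℝ)) (3 * c (3 * r - 1) - 2)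
      have hs' := le_max_right (1 - 3 * (c (3 * r - 1) : ℝ)) (3 * c (3 * r - 1) - 2)
      simp only [Set.Icc.coe_one]
      linarith
    · rw [c1 (r := 3 * r - 1) (by linarith)]
      refine le_add_of_le_of_nonneg (le_max_of_le_right ?_)
        (mul_nonneg zero_le_two (c _).2.1)
      norm_num
  refine ⟨fun a => ⟨(a.1.1.1, M a), hpM a.1 a.2⟩, by fun_prop, fun z => ?_, fun z => ?_,
    fun _ _ => rfl⟩
  · apply Subtype.ext
    rw [hω]
    simp only [M]
    rw [c0 (by norm_num), c0 (by norm_num), hG'0]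
    simp only [γ]
    rw [if_pos (by norm_num), c1 (by norm_num)]
  · apply Subtype.ext
    rw [hω']
    simp only [M]
    rw [c1 (by norm_num), c0 (by norm_num), hG'0]
    simp only [γ]
    rw [if_neg (by norm_num), c1 (by norm_num)]
end

section
/- Let p : E → B be a fibration and let f : B' → B be a homotopy equivalence. Then the canonical map f̄ : f*E → E, (b',e) ↦ e, is a homotopy equivalence. -/
open unitInterval

open ContinuousMap

section HomotopyPullback

variable {A X Y E B : Type} [TopologicalSpace A] [TopologicalSpace X] [TopologicalSpace Y]
  [TopologicalSpace E] [TopologicalSpace B]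

theorem homotopicMaps_iff_homotopic (u v : C(X, Y)) : HomotopicMaps u v ↔ u.Homotopic v := by
  constructor
  · rintro ⟨H, hH, h0, h1⟩
    exact ⟨⟨⟨fun x => H (x.2, x.1), by fun_prop⟩, h0, h1⟩⟩
  · rintro ⟨H⟩
    exact ⟨fun x => H (x.2, x.1), by fun_prop, fun x => H.apply_zero x, fun x => H.apply_one x⟩

theorem IsFibration.exists_lift {p : E → B} (hp : IsFibration p) (g : C(A, E)) (G : C(A × I, B))
    (h0 : ∀ a, G (a, 0) = p (g a)) :
    ∃ L : C(A × I, E), (∀ a, L (a, 0) = g a) ∧ ∀ a t, p (L (a, t)) = G (a, t) := by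
  obtain ⟨L, hL, hL0, hLp⟩ := hp A _ g G g.continuous G.continuous h0
  exact ⟨⟨L, hL⟩, hL0, fun a t => hLp (a, t)⟩

/-- The pullback of `p` along `φ`. -/
abbrev PullbackSpace (φ : X → B) (p : E → B) : Type := {be : X × E // φ be.1 = p be.2}

/-- The canonical map from the pullback of `p` along `φ` to the total space of `p`. -/
def pullbackMap (φ : X → B) (p : E → B) : C(PullbackSpace φ p, E) where
  toFun z := z.1.2
  continuous_toFun := by fun_prop

/-- The map of pullbacks of `p` induced by a map `g` of bases. -/
def pullbackBaseMap (φ : X → B) (g : C(Y, X)) (p : E → B) :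
    C(PullbackSpace (φ ∘ g) p, PullbackSpace φ p) where
  toFun z := ⟨(g z.1.1, z.1.2), z.2⟩
  continuous_toFun := by fun_prop

/-- If `g` has a right homotopy inverse, so does the map it induces on pullbacks of a fibration. -/
theorem IsFibration.exists_right_inverse_pullbackBaseMap {p : E → B} (hp : IsFibration p)
    (φ : C(X, B)) (g : C(Y, X)) (k : C(X, Y)) (h : (g.comp k).Homotopic (.id X)) :
    ∃ s : C(PullbackSpace φ p, PullbackSpace (φ ∘ g) p),
      ((pullbackBaseMap φ g p).comp s).Homotopic (.id _) := by
  obtain ⟨J⟩ := h.symm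
  obtain ⟨L, hL0, hLp⟩ := hp.exists_lift (pullbackMap φ p)
    ⟨fun x => φ (J (x.2, x.1.1.1)), by fun_prop⟩ (fun z => by simpa [pullbackMap] using z.2)
  refine ⟨⟨fun z => ⟨(k z.1.1, L (z, 1)), by simp [hLp]⟩, by fun_prop⟩, Homotopic.symm ?_⟩
  refine (homotopicMaps_iff_homotopic _ _).1
    ⟨fun x => ⟨(J (x.2, x.1.1.1), L x), (hLp _ _).symm⟩, by fun_prop, ?_, ?_⟩
  · intro z
    ext <;> simp [hL0, pullbackMap]
  · intro z
    ext <;> simp [pullbackBaseMap]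

/-- If `h` is homotopic to the identity, then the canonical map from the pullback of a fibration
along `h` to its total space is a homotopy equivalence. -/
theorem IsFibration.exists_inverse_pullbackMap_of_homotopic_id {p : E → B} (hpc : Continuous p)
    (hp : IsFibration p) (h : C(B, B)) (hh : h.Homotopic (.id B)) :
    ∃ v : C(E, PullbackSpace h p),
      (v.comp (pullbackMap h p)).Homotopic (.id _) ∧
        ((pullbackMap h p).comp v).Homotopic (.id _) := by
  obtain ⟨H⟩ := hh
  let π := pullbackMap H p
  let i₀ : C(PullbackSpace h p, PullbackSpace H p) :=
    ⟨fun z => ⟨((0, z.1.1), z.1.2), by simpa using z.2⟩, by fun_prop⟩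
  let i₁ : C(E, PullbackSpace H p) := ⟨fun e => ⟨((1, p e), e), by simp⟩, by fun_prop⟩
  obtain ⟨L, hL0, hLp⟩ := hp.exists_lift π
    ⟨fun x => H (x.1.1.1.1 * σ x.2, x.1.1.1.2), by fun_prop⟩
    (fun z => by simpa [π, pullbackMap] using z.2)
  obtain ⟨M, hM0, hMp⟩ := hp.exists_lift π
    ⟨fun x => H (σ (σ x.1.1.1.1 * σ x.2), x.1.1.1.2), by fun_prop⟩
    (fun z => by simpa [π, pullbackMap] using z.2)
  let r₀ : C(PullbackSpace H p, PullbackSpace h p) :=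
    ⟨fun z => ⟨(z.1.1.2, L (z, 1)), by simp [hLp]⟩, by fun_prop⟩
  let r₁ : C(PullbackSpace H p, E) := ⟨fun z => M (z, 1), by fun_prop⟩
  have hi₀r₀ : (i₀.comp r₀).Homotopic (.id _) := by
    refine Homotopic.symm ((homotopicMaps_iff_homotopic _ _).1
      ⟨fun x => ⟨((x.1.1.1.1 * σ x.2, x.1.1.1.2), L x), (hLp _ _).symm⟩, by fun_prop, ?_, ?_⟩)
    · intro z
      ext <;> simp [hL0, π, pullbackMap]
    · intro z
      ext <;> simp [i₀, r₀]
  have hr₀i₀ : (r₀.comp i₀).Homotopic (.id _) := by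
    refine Homotopic.symm ((homotopicMaps_iff_homotopic _ _).1
      ⟨fun x => ⟨(x.1.1.1, L (i₀ x.1, x.2)), by simp [hLp, i₀]⟩, by fun_prop, ?_, ?_⟩)
    · intro z
      ext <;> simp [hL0, π, pullbackMap, i₀]
    · intro z
      ext <;> simp [i₀, r₀]
  have hi₁r₁ : (i₁.comp r₁).Homotopic (.id _) := by
    refine Homotopic.symm ((homotopicMaps_iff_homotopic _ _).1
      ⟨fun x => ⟨((σ (σ x.1.1.1.1 * σ x.2), x.1.1.1.2), M x), (hMp _ _).symm⟩,
        by fun_prop, ?_, ?_⟩)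
    · intro z
      ext <;> simp [hM0, π, pullbackMap]
    · intro z
      ext <;> simp [i₁, r₁, hMp]
  have hi₁π : (i₁.comp π).Homotopic (.id _) :=
    (((Homotopic.refl (i₁.comp π)).comp hi₁r₁).symm).trans hi₁r₁
  refine ⟨r₀.comp i₁, ?_, ?_⟩
  · exact ((Homotopic.refl r₀).comp (hi₁π.comp (Homotopic.refl i₀))).trans hr₀i₀
  · exact (Homotopic.refl π).comp (hi₀r₀.comp (Homotopic.refl i₁))

end HomotopyPullback

/-- If `p : E → B` is a fibration and `f : B' → B` is a homotopy equivalence,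
then the canonical map `f̄ : f*E → E` is a homotopy equivalence. -/
theorem pullback_map_homotopyEquiv_of_homotopyEquiv
    {E B B' : Type} [TopologicalSpace E] [TopologicalSpace B] [TopologicalSpace B']
    (p : E → B) (hpc : Continuous p) (hp : IsFibration p)
    (f : B' → B) (hf : IsHomotopyEquiv f) :
    IsHomotopyEquiv (fun z : {be : B' × E // f be.1 = p be.2} => z.1.2) := by
  obtain ⟨hfc, g, hgc, hgf, hfg⟩ := hf
  let f' : C(B', B) := ⟨f, hfc⟩
  let g' : C(B, B') := ⟨g, hgc⟩
  obtain ⟨v, hv, hv'⟩ := hp.exists_inverse_pullbackMap_of_homotopic_id hpc (f'.comp g')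
    ((homotopicMaps_iff_homotopic (f'.comp g') (.id B)).1 hfg)
  obtain ⟨s, hs⟩ := hp.exists_right_inverse_pullbackBaseMap f' g' f'
    ((homotopicMaps_iff_homotopic (g'.comp f') (.id B')).1 hgf)
  let fbar := pullbackMap f p
  let gbar := pullbackBaseMap f g' p
  let w := gbar.comp v
  have hw : (w.comp fbar).Homotopic (.id _) :=
    ((Homotopic.refl (w.comp fbar)).comp hs).symm.trans
      (((Homotopic.refl gbar).comp (hv.comp (Homotopic.refl s))).trans hs)
  exact ⟨fbar.continuous, w, w.continuous, (homotopicMaps_iff_homotopic _ _).2 hw,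
    (homotopicMaps_iff_homotopic _ _).2 hv'⟩
end

section
/- Let p : E → B be a fibration, f : X → B a continuous map, b ∈ B, and let H : X × [0,1] → B be a nullhomotopy from f to the constant map at b. Then for every lifting solution H' for H, the associated fiber transport f*E → (const_b)*E = p⁻¹(b) × X is a trivialization of f*E: it is a fiber homotopy equivalence over X whose restriction to each fiber p⁻¹(f(x)) → p⁻¹(b) is a fiber transport. -/
open unitInterval

/-- A map `p⁻¹(b) → p⁻¹(b')` between fibers is a fiber transport if it is homotopic to a
transport along some path from `b` to `b'`. -/
def IsFiberTransport {E B : Type} [TopologicalSpace E] [TopologicalSpace B]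
    (p : E → B) (b b' : B) (u : {e : E // p e = b} → {e : E // p e = b'}) : Prop :=
  ∃ γ : I → B, Continuous γ ∧ γ 0 = b ∧ γ 1 = b' ∧
    ∃ K : {e : E // p e = b} × I → E, Continuous K ∧ (∀ e, K (e, 0) = e.1) ∧
      (∀ e t, p (K (e, t)) = γ t) ∧
      ∃ w : {e : E // p e = b} → {e : E // p e = b'},
        (∀ e, (w e).1 = K (e, 1)) ∧ HomotopicMaps u w

/-- A trivialization of `f*E` is a fiber homotopy equivalence `f*E → p⁻¹(b) × X` over `X` whose
restriction to each fiber is a fiber transport. -/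
def IsTrivialization {E B X : Type} [TopologicalSpace E] [TopologicalSpace B] [TopologicalSpace X]
    (p : E → B) (f : X → B) (b : B)
    (φ : {xe : X × E // f xe.1 = p xe.2} → {e : E // p e = b} × X) : Prop :=
  IsFiberHomotopyEquiv (fun z => z.1.1) Prod.snd φ ∧
    ∀ x : X, IsFiberTransport p (f x) b (fun e => (φ ⟨(x, e.1), e.2.symm⟩).1)

/-- Homotopies `P` and `Q` with `P (a, 1) = Q (a, 0)` can be concatenated. -/
theorem exists_concat_s4 {A Y : Type} [TopologicalSpace A] [TopologicalSpace Y]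
    {P Q : A × I → Y} (hP : Continuous P) (hQ : Continuous Q) (h : ∀ a, P (a, 1) = Q (a, 0)) :
    ∃ R : A × I → Y, Continuous R ∧
      (∀ a (s : I), (s : ℝ) ≤ 1 / 2 → R (a, s) = P (a, Set.projIcc 0 1 zero_le_one (2 * s))) ∧
      ∀ a (s : I), 1 / 2 ≤ (s : ℝ) → R (a, s) = Q (a, Set.projIcc 0 1 zero_le_one (2 * s - 1)) := by
  have hmid : ∀ (a : A) (s : I), (s : ℝ) = 1 / 2 →
      P (a, Set.projIcc 0 1 zero_le_one (2 * s)) =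
        Q (a, Set.projIcc 0 1 zero_le_one (2 * s - 1)) := by
    intro a s hs
    rw [Set.projIcc_of_right_le _ (by linarith), Set.projIcc_of_le_left _ (by linarith)]
    exact h a
  refine ⟨fun x => if (x.2 : ℝ) ≤ 1 / 2 then P (x.1, Set.projIcc 0 1 zero_le_one (2 * x.2))
    else Q (x.1, Set.projIcc 0 1 zero_le_one (2 * x.2 - 1)), ?_, ?_, ?_⟩
  · refine Continuous.if_le ?_ ?_ (by fun_prop) continuous_const fun x hx => hmid x.1 x.2 hx
    · exact hP.comp (continuous_fst.prodMk (continuous_projIcc.comp (by fun_prop)))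
    · exact hQ.comp (continuous_fst.prodMk (continuous_projIcc.comp (by fun_prop)))
  · intro a s hs
    exact if_pos hs
  · intro a s hs
    by_cases hs' : (s : ℝ) ≤ 1 / 2
    · exact (if_pos hs').trans (hmid a s (le_antisymm hs' hs))
    · exact if_neg hs'

/-- Two lifts of the same homotopy with the same start have vertically homotopic ends. -/
theorem IsFibration.fiberHomotopic_of_lifts {A E B : Type} [TopologicalSpace A]
    [TopologicalSpace E] [TopologicalSpace B] {p : E → B} (hp : IsFibration p)
    {G : A × I → B} (hG : Continuous G) {P Q : A × I → E} (hP : Continuous P) (hQ : Continuous Q)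
    (hPG : ∀ x, p (P x) = G x) (hQG : ∀ x, p (Q x) = G x) (h0 : ∀ a, P (a, 0) = Q (a, 0)) :
    FiberHomotopic (fun a => G (a, 1)) p (fun a => P (a, 1)) (fun a => Q (a, 1)) := by
  obtain ⟨R, hR, hRP, hRQ⟩ := exists_concat_s4 (P := fun x : A × I => P (x.1, σ x.2))
    (by fun_prop) hQ (by simpa using h0)
  have hR0 : ∀ a, R (a, 0) = P (a, 1) := fun a => by
    rw [hRP a 0 (by norm_num), Set.projIcc_of_le_left _ (by norm_num)]
    exact congrArg (fun t => P (a, t)) unitInterval.symm_zero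
  have hR1 : ∀ a, R (a, 1) = Q (a, 1) := fun a => by
    rw [hRQ a 1 (by norm_num), Set.projIcc_of_right_le _ (by norm_num)]
    rfl
  set c : I → I := fun s => Set.projIcc 0 1 zero_le_one |1 - 2 * (s : ℝ)| with hc
  have hcc : Continuous c := continuous_projIcc.comp (by fun_prop)
  have hc0 : c 0 = 1 := Set.projIcc_of_right_le _ (by norm_num)
  have hc1 : c 1 = 1 := Set.projIcc_of_right_le _ (by norm_num)
  have hRG : ∀ a s, p (R (a, s)) = G (a, c s) := by
    intro a s
    rcases le_total (s : ℝ) (1 / 2) with h | h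
    · rw [hRP a s h, hPG]
      simp only [hc]
      rw [unitInterval.symm_projIcc, abs_of_nonneg (by linarith)]
    · rw [hRQ a s h, hQG]
      simp only [hc]
      rw [abs_of_nonpos (by linarith), neg_sub]
  obtain ⟨L, hL, hL0, hLG⟩ := hp (A × I) inferInstance R
    (fun x => G (x.1.1, max (c x.1.2) x.2)) hR (by fun_prop) (fun ⟨a, s⟩ => by
      rw [hRG]
      exact congrArg (fun t => G (a, t)) (max_eq_left (c s).2.1))
  have left : FiberHomotopic (fun a => G (a, 1)) p (fun a => P (a, 1))
      (fun a => L ((a, 0), 1)) :=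
    ⟨fun x => L ((x.1, 0), x.2), by fun_prop, fun a => by simp [hL0, hR0], fun a => rfl,
      fun a t => by simp [hLG, hc0, max_eq_left unitInterval.le_one']⟩
  have middle : FiberHomotopic (fun a => G (a, 1)) p (fun a => L ((a, 0), 1))
      (fun a => L ((a, 1), 1)) :=
    ⟨fun x => L (x, 1), by fun_prop, fun a => rfl, fun a => rfl,
      fun a t => by simp [hLG, max_eq_right unitInterval.le_one']⟩
  have right : FiberHomotopic (fun a => G (a, 1)) p (fun a => Q (a, 1))
      (fun a => L ((a, 1), 1)) :=
    ⟨fun x => L ((x.1, 1), x.2), by fun_prop, fun a => by simp [hL0, hR1], fun a => rfl,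
      fun a t => by simp [hLG, hc1, max_eq_left unitInterval.le_one']⟩
  exact (left.trans middle).trans right.symm

/-- Given a fibration `p : E → B` and a nullhomotopy `H` of `f : X → B` to the
constant map at `b`, every lifting solution `H'` for `H` yields a trivialization
`T : f*E → p⁻¹(b) × X`. -/
theorem nullhomotopy_yields_trivialization
    {E B X : Type} [TopologicalSpace E] [TopologicalSpace B] [TopologicalSpace X]
    (p : E → B) (hpc : Continuous p) (hp : IsFibration p)
    (f : X → B) (hf : Continuous f) (b : B)
    (H : X × I → B) (hH : Continuous H)
    (hH0 : ∀ x, H (x, 0) = f x) (hH1 : ∀ x, H (x, 1) = b)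
    (H' : {xe : X × E // f xe.1 = p xe.2} × I → E)
    (hH'c : Continuous H')
    (hH'0 : ∀ z, H' (z, 0) = z.1.2)
    (hH'p : ∀ z t, p (H' (z, t)) = H (z.1.1, t))
    (T : {xe : X × E // f xe.1 = p xe.2} → {e : E // p e = b} × X)
    (hT1 : ∀ z, ((T z).1 : {e : E // p e = b}).1 = H' (z, 1))
    (hT2 : ∀ z, (T z).2 = z.1.1) :
    IsTrivialization p f b T := by
  have hTc : Continuous T := by
    have h1 : Continuous fun z => (T z).1 := by
      refine continuous_induced_rng.2 ?_
      simp only [Function.comp_def, hT1]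
      fun_prop
    have h2 : Continuous fun z => (T z).2 := by
      simp only [hT2]
      fun_prop
    exact h1.prodMk h2
  refine ⟨⟨hTc, hT2, ?_⟩, fun x => ?_⟩
  · obtain ⟨K, hK, hK0, hKH⟩ := hp ({e : E // p e = b} × X) inferInstance (fun y => y.1.1)
      (fun y => H (y.1.2, σ y.2)) (by fun_prop) (by fun_prop)
      (fun y => by simp [hH1, y.1.2])
    have hv : ∀ y, f y.2 = p (K (y, 1)) := fun y => by simp [hKH, hH0]
    refine ⟨fun y => ⟨(y.2, K (y, 1)), hv y⟩, by fun_prop, fun y => rfl, ?_, ?_⟩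
    · obtain ⟨L, hL, hL0, hL1, hLp⟩ := hp.fiberHomotopic_of_lifts
        (G := fun y : {xe : X × E // f xe.1 = p xe.2} × I => H (y.1.1.1, σ y.2))
        (P := fun y => K (T y.1, y.2)) (Q := fun y => H' (y.1, σ y.2))
        (by fun_prop) (by fun_prop) (by fun_prop) (fun y => by simp [hKH, hT2])
        (fun y => hH'p _ _) (fun z => by simp [hK0, hT1])
      have hfL : ∀ y, f y.1.1.1 = p (L y) := fun y => by
        rw [hLp y.1 y.2]
        simp [hH0]
      refine ⟨fun y => ⟨(y.1.1.1, L y), hfL y⟩, by fun_prop, fun z => ?_, fun z => ?_,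
        fun z t => rfl⟩
      · exact Subtype.ext (Prod.ext (hT2 z).symm (hL0 z))
      · exact Subtype.ext (Prod.ext rfl ((hL1 z).trans (by simp [hH'0])))
    · obtain ⟨L, hL, hL0, hL1, hLp⟩ := hp.fiberHomotopic_of_lifts
        (G := fun y : ({e : E // p e = b} × X) × I => H (y.1.2, y.2))
        (P := fun y => H' (⟨(y.1.2, K (y.1, 1)), hv y.1⟩, y.2)) (Q := fun y => K (y.1, σ y.2))
        (by fun_prop) (by fun_prop) (by fun_prop) (fun y => hH'p _ _)
        (fun y => by simp [hKH]) (fun y => by simp [hH'0])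
      refine ⟨fun y => (⟨L y, (hLp y.1 y.2).trans (hH1 _)⟩, y.1.2), by fun_prop, fun y => ?_,
        fun y => ?_, fun y t => rfl⟩
      · exact Prod.ext (Subtype.ext ((hL0 y).trans (hT1 _).symm)) (hT2 ⟨(y.2, K (y, 1)), hv y⟩).symm
      · exact Prod.ext (Subtype.ext ((hL1 y).trans (by simp [hK0]))) rfl
  · refine ⟨fun t => H (x, t), by fun_prop, hH0 x, hH1 x,
      fun y => H' (⟨(x, y.1.1), y.1.2.symm⟩, y.2), by fun_prop, fun e => hH'0 _,
      fun e t => hH'p _ _, _, fun e => hT1 _, ?_⟩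
    exact ⟨fun y => (T ⟨(x, y.1.1), y.1.2.symm⟩).1, by fun_prop, fun e => rfl, fun e => rfl⟩
end

section
/- Let p : E → B be a fibration, X a contractible topological space, and f : X → B continuous. Let T : f*E → p⁻¹(b) × X and T' : f*E → p⁻¹(b') × X be two trivializations of f*E. Then there exists a fiber transport g : p⁻¹(b) → p⁻¹(b') such that (g × id_X) ∘ T and T' are fiber homotopic over X. -/
open unitInterval

/-- Two maps `a c : A → E` are connected over a path `γ` in `B` if there is a homotopy from `a`
to `c` which at each time `t` takes values in the fiber over `γ t`. -/
def HomotopicOverPath {A E B : Type} [TopologicalSpace A] [TopologicalSpace E] [TopologicalSpace B]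
    (p : E → B) (x y : B) (a c : C(A, E)) : Prop :=
  ∃ (γ : Path x y) (H : a.Homotopy c), ∀ t e, p (H (t, e)) = γ t

namespace HomotopicOverPath

variable {A A' E B : Type} [TopologicalSpace A] [TopologicalSpace A'] [TopologicalSpace E]
  [TopologicalSpace B] {p : E → B} {x y z : B} {a c d : C(A, E)}

theorem symm (h : HomotopicOverPath p x y a c) : HomotopicOverPath p y x c a := by
  obtain ⟨γ, H, hH⟩ := h
  exact ⟨γ.symm, H.symm, fun t e => hH _ e⟩

theorem trans (h : HomotopicOverPath p x y a c) (h' : HomotopicOverPath p y z c d) :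
    HomotopicOverPath p x z a d := by
  obtain ⟨γ, H, hH⟩ := h
  obtain ⟨γ', H', hH'⟩ := h'
  refine ⟨γ.trans γ', H.trans H', fun t e => ?_⟩
  rw [ContinuousMap.Homotopy.trans_apply, Path.trans_apply]
  split_ifs
  · exact hH _ e
  · exact hH' _ e

theorem comp_right (h : HomotopicOverPath p x y a c) (k : C(A', A)) :
    HomotopicOverPath p x y (a.comp k) (c.comp k) := by
  obtain ⟨γ, H, hH⟩ := h
  exact ⟨γ, H.comp (ContinuousMap.Homotopy.refl k), fun t e => hH t (k e)⟩

end HomotopicOverPath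

section FiberTransport

variable {A E B : Type} [TopologicalSpace A] [TopologicalSpace E] [TopologicalSpace B]
  {p : E → B} {b b' : B}

/-- A homotopy inside a single fiber is a homotopy over the constant path. -/
theorem HomotopicMaps.homotopicOverPath {u w : A → {e : E // p e = b}}
    (h : HomotopicMaps u w) (hu : Continuous fun e => (u e).1) (hw : Continuous fun e => (w e).1) :
    HomotopicOverPath p b b ⟨fun e => (u e).1, hu⟩ ⟨fun e => (w e).1, hw⟩ := by
  obtain ⟨H, hH, h0, h1⟩ := h
  exact ⟨Path.refl b,
    { toFun := fun q => (H (q.2, q.1)).1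
      continuous_toFun := by fun_prop
      map_zero_left := fun e => by simp [h0]
      map_one_left := fun e => by simp [h1] }, fun t e => (H (e, t)).2⟩

/-- A fiber transport is joined to the inclusion of the fiber by a homotopy over a path. -/
theorem IsFiberTransport.homotopicOverPath {u : {e : E // p e = b} → {e : E // p e = b'}}
    (h : IsFiberTransport p b b' u) (hu : Continuous fun e => (u e).1) :
    HomotopicOverPath p b b' ⟨Subtype.val, continuous_subtype_val⟩ ⟨fun e => (u e).1, hu⟩ := by
  obtain ⟨γ, hγ, hγ0, hγ1, K, hK, hK0, hKp, w, hw, huw⟩ := h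
  have hwc : Continuous fun e => (w e).1 := by
    simp only [hw]
    fun_prop
  refine HomotopicOverPath.trans ?_ (huw.homotopicOverPath hu hwc).symm
  exact ⟨⟨⟨γ, hγ⟩, hγ0, hγ1⟩,
    { toFun := fun q => K (q.2, q.1)
      continuous_toFun := by fun_prop
      map_zero_left := fun e => by simp [hK0]
      map_one_left := fun e => by simp [hw] }, fun t e => hKp e t⟩

theorem HomotopicOverPath.isFiberTransport {u : {e : E // p e = b} → {e : E // p e = b'}}
    (hu : Continuous fun e => (u e).1)
    (h : HomotopicOverPath p b b' ⟨Subtype.val, continuous_subtype_val⟩ ⟨fun e => (u e).1, hu⟩) :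
    IsFiberTransport p b b' u := by
  obtain ⟨γ, H, hH⟩ := h
  refine ⟨γ, γ.continuous, γ.source, γ.target, fun q => H (q.2, q.1), by fun_prop,
    fun e => by simp, fun e t => hH t e, u, fun e => by simp, fun q => u q.1, ?_,
    fun _ => rfl, fun _ => rfl⟩
  exact (continuous_induced_rng.2 hu).comp continuous_fst

end FiberTransport

/-- Over a contractible space `X`, any two trivializations
`T : f*E → p⁻¹(b) × X` and `T' : f*E → p⁻¹(b') × X` differ by a fiber transport
`g : p⁻¹(b) → p⁻¹(b')`, up to fiber homotopy over `X`. -/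
theorem trivializations_differ_by_fiber_transport
    {E B X : Type} [TopologicalSpace E] [TopologicalSpace B] [TopologicalSpace X]
    [ContractibleSpace X]
    (p : E → B) (hpc : Continuous p) (hp : IsFibration p)
    (f : X → B) (hf : Continuous f) (b b' : B)
    (T : {xe : X × E // f xe.1 = p xe.2} → {e : E // p e = b} × X)
    (hT : IsTrivialization p f b T)
    (T' : {xe : X × E // f xe.1 = p xe.2} → {e : E // p e = b'} × X)
    (hT' : IsTrivialization p f b' T') :
    ∃ g : {e : E // p e = b} → {e : E // p e = b'},
      IsFiberTransport p b b' g ∧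
        FiberHomotopic (fun z : {xe : X × E // f xe.1 = p xe.2} => z.1.1) Prod.snd
          (fun z => (g (T z).1, (T z).2)) T' := by
  obtain ⟨⟨hTc, hTX, V, hVc, hVX, hVT, LT, hLTc, hLT0, hLT1, hLTX⟩, hTt⟩ := hT
  obtain ⟨⟨hTc', hTX', -⟩, hTt'⟩ := hT'
  obtain ⟨L, hLc, hL0, hL1, hLX⟩ := hVT
  obtain ⟨x₀, ⟨C⟩⟩ := id_nullhomotopic X
  have hVf (e : {e : E // p e = b}) : p (V (e, x₀)).1.2 = f x₀ := by
    rw [← (V (e, x₀)).2]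
    exact congrArg f (hVX (e, x₀))
  let v : {e : E // p e = b} → {e : E // p e = f x₀} := fun e => ⟨(V (e, x₀)).1.2, hVf e⟩
  have hv : Continuous v := by fun_prop
  have hvV (e : {e : E // p e = b}) :
      (⟨(x₀, (v e).1), (v e).2.symm⟩ : {xe : X × E // f xe.1 = p xe.2}) = V (e, x₀) :=
    Subtype.ext (Prod.ext (hVX (e, x₀)).symm rfl)
  have hu : Continuous fun e : {e : E // p e = f x₀} => (T ⟨(x₀, e.1), e.2.symm⟩).1.1 := by
    fun_prop
  have hu' : Continuous fun e : {e : E // p e = f x₀} => (T' ⟨(x₀, e.1), e.2.symm⟩).1.1 := by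
    fun_prop
  have huv : HomotopicMaps (fun e => (T (V (e, x₀))).1) (fun e : {e : E // p e = b} => e) :=
    ⟨fun q => (LT ((q.1, x₀), q.2)).1, by fun_prop, fun e => congrArg Prod.fst (hLT0 (e, x₀)),
      fun e => congrArg Prod.fst (hLT1 (e, x₀))⟩
  refine ⟨fun e => (T' (V (e, x₀))).1, ?_, ?_⟩
  · have h₁ := (huv.homotopicOverPath (by fun_prop) continuous_subtype_val).symm
    have h₂ := ((hTt x₀).homotopicOverPath hu).symm.comp_right ⟨v, hv⟩
    have h₃ := ((hTt' x₀).homotopicOverPath hu').comp_right ⟨v, hv⟩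
    simp only [ContinuousMap.comp, ContinuousMap.coe_mk, Function.comp_def, hvV] at h₂ h₃
    exact HomotopicOverPath.isFiberTransport (by fun_prop) (h₁.trans (h₂.trans h₃))
  · refine FiberHomotopic.trans (v := fun z => T' (V (T z)))
      ⟨fun q => ((T' (V ((T q.1).1, C.symm (q.2, (T q.1).2)))).1, (T q.1).2), by fun_prop,
        fun d => by simp, fun d => ?_, fun d t => hTX d⟩
      ⟨fun q => T' (L q), by fun_prop, fun d => congrArg T' (hL0 d),
        fun d => congrArg T' (hL1 d), fun d t => (hTX' _).trans (hLX d t)⟩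
    refine Prod.ext (by simp) ?_
    simp only [hTX', hVX]
end

section
/- Let f, g : X → Y be continuous maps and H : X × [0,1] → Y a homotopy from f to g. Then there exists a continuous map ω_H : X^f → X^g with p_g ∘ ω_H = p_f which is a fiber homotopy equivalence over Y, and such that ω_H ∘ λ_f is homotopic to λ_g as maps X → X^g (where λ_f : X → X^f and λ_g : X → X^g are the canonical inclusions). -/
open unitInterval

/-- The total space of the fibration associated with `f`. -/
abbrev AssociatedSpace {X Y : Type} [TopologicalSpace X] [TopologicalSpace Y] (f : X → Y) : Type :=
  {xγ : X × C(I, Y) // xγ.2 0 = f xγ.1}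

namespace AssociatedSpace

variable {A X Y : Type} [TopologicalSpace A] [TopologicalSpace X] [TopologicalSpace Y]
  {f g : X → Y} {H : X × I → Y}

theorem exists_continuous_lift (m : A → X) (hm : Continuous m) (F : A × I → Y)
    (hF : Continuous F) (hF0 : ∀ a, F (a, 0) = g (m a)) :
    ∃ u : A → AssociatedSpace g, Continuous u ∧ (∀ a, (u a).1.1 = m a) ∧
      ∀ a t, (u a).1.2 t = F (a, t) :=
  ⟨fun a => ⟨(m a, (ContinuousMap.mk F hF).curry a), hF0 a⟩,
    (hm.prodMk (ContinuousMap.mk F hF).curry.continuous).subtype_mk _,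
    fun _ => rfl, fun _ _ => rfl⟩

theorem ext {z w : AssociatedSpace f} (h₁ : z.1.1 = w.1.1) (h₂ : ∀ t, z.1.2 t = w.1.2 t) :
    z = w :=
  Subtype.ext (Prod.ext h₁ (ContinuousMap.ext h₂))

/-- The track of `H` at height `h` for `r ≤ 0`, and the path of `z` at time `r` for `0 < r`,
both parameters being clamped to the unit interval. -/
noncomputable def glue (H : X × I → Y) (z : AssociatedSpace f) (h r : ℝ) : Y :=
  if r ≤ 0 then H (z.1.1, Set.projIcc 0 1 zero_le_one h)
  else z.1.2 (Set.projIcc 0 1 zero_le_one r)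

theorem continuous_glue (hH : Continuous H) (hH0 : ∀ x, H (x, 0) = f x)
    {z : A → AssociatedSpace f} {h r : A → ℝ} (hz : Continuous z) (hh : Continuous h)
    (hr : Continuous r) (h_nonpos : ∀ a, r a = 0 → h a ≤ 0) :
    Continuous fun a => glue H (z a) (h a) (r a) := by
  have hz₁ : Continuous fun a => (z a).1.1 := by fun_prop
  have hz₂ : Continuous fun a => (z a).1.2 := by fun_prop
  refine Continuous.if_le (hH.comp (hz₁.prodMk (continuous_projIcc.comp hh)))
    (hz₂.eval (continuous_projIcc.comp hr)) hr continuous_const fun a ha => ?_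
  rw [Set.projIcc_of_le_left _ (h_nonpos a ha), Set.projIcc_of_le_left _ ha.le]
  exact (hH0 _).trans (z a).2.symm

theorem glue_of_nonpos {z : AssociatedSpace f} {h r : ℝ} (hr : r ≤ 0) :
    glue H z h r = H (z.1.1, Set.projIcc 0 1 zero_le_one h) :=
  if_pos hr

theorem glue_of_nonneg (hH0 : ∀ x, H (x, 0) = f x) {z : AssociatedSpace f} {h r : ℝ}
    (hr : 0 ≤ r) (h_nonpos : r = 0 → h ≤ 0) :
    glue H z h r = z.1.2 (Set.projIcc 0 1 zero_le_one r) := by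
  rcases hr.eq_or_lt with rfl | hr
  · rw [glue_of_nonpos le_rfl, Set.projIcc_of_le_left _ (h_nonpos rfl),
      Set.projIcc_of_le_left _ le_rfl]
    exact (hH0 _).trans z.2.symm
  · exact if_neg hr.not_ge

/-- Prepending the reversed track of a homotopy is a continuous map over the base. -/
theorem exists_transport (hH : Continuous H) (hH0 : ∀ x, H (x, 0) = f x)
    (hH1 : ∀ x, H (x, 1) = g x) :
    ∃ u : AssociatedSpace f → AssociatedSpace g, Continuous u ∧ (∀ z, (u z).1.1 = z.1.1) ∧
      ∀ z (t : I), (u z).1.2 t = glue H z (1 - 2 * t) (2 * t - 1) := by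
  refine exists_continuous_lift (fun z => z.1.1) (by fun_prop)
    (fun p => glue H p.1 (1 - 2 * p.2) (2 * p.2 - 1))
    (continuous_glue hH hH0 (by fun_prop) (by fun_prop) (by fun_prop) fun _ _ => by linarith)
    fun z => ?_
  rw [glue_of_nonpos (by simp), Set.projIcc_of_right_le _ (by simp)]
  exact hH1 _

theorem transport_apply_one (hH0 : ∀ x, H (x, 0) = f x)
    {u : AssociatedSpace f → AssociatedSpace g}
    (hu : ∀ z (t : I), (u z).1.2 t = glue H z (1 - 2 * t) (2 * t - 1)) (z : AssociatedSpace f) :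
    (u z).1.2 1 = z.1.2 1 := by
  rw [hu, glue_of_nonneg hH0 (by norm_num) (by norm_num),
    Set.projIcc_of_right_le _ (by norm_num)]
  rfl

/-- Transport along `H` followed by transport along the reverse of `H` is fiber homotopic to the
identity. -/
theorem fiberHomotopic_transport_reverse (hH : Continuous H) (hH0 : ∀ x, H (x, 0) = f x)
    (hH1 : ∀ x, H (x, 1) = g x) {K : X × I → Y} (hK : ∀ x t, K (x, t) = H (x, σ t))
    {u : AssociatedSpace f → AssociatedSpace g} {v : AssociatedSpace g → AssociatedSpace f}
    (hu₁ : ∀ z, (u z).1.1 = z.1.1)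
    (hu₂ : ∀ z (t : I), (u z).1.2 t = glue H z (1 - 2 * t) (2 * t - 1))
    (hv₁ : ∀ z, (v z).1.1 = z.1.1)
    (hv₂ : ∀ z (t : I), (v z).1.2 t = glue K z (1 - 2 * t) (2 * t - 1)) :
    FiberHomotopic (fun z : AssociatedSpace f => z.1.2 1) (fun z : AssociatedSpace f => z.1.2 1)
      (fun z => v (u z)) id := by
  have hK0 (x : X) : K (x, 0) = g x := by rw [hK, unitInterval.symm_zero, hH1]
  let r (s t : ℝ) : ℝ := (1 - s) * max (4 * t - 3) (2 * t - 2) + s * t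
  let h (s t : ℝ) : ℝ := min (-r s t) (2 * (1 - s) + r s t)
  obtain ⟨L, hL, hL₁, hL₂⟩ := exists_continuous_lift (g := f)
    (fun p : AssociatedSpace f × I => p.1.1.1) (by fun_prop)
    (fun q => glue H q.1.1 (h q.1.2 q.2) (r q.1.2 q.2))
    (continuous_glue hH hH0 (by fun_prop) (by fun_prop) (by fun_prop)
      fun _ ha => (min_le_left _ _).trans (by linarith))
    (by
      rintro ⟨z, s⟩
      have hr : r s 0 = -2 * (1 - s) := by norm_num [r]; ring
      have hs := s.2.2
      have hh : h s 0 ≤ 0 := (min_le_right _ _).trans (by linarith)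
      change glue H z (h s 0) (r s 0) = _
      rw [glue_of_nonpos (by linarith), Set.projIcc_of_le_left _ hh]
      exact hH0 _)
  refine ⟨L, hL, fun z => ext ?_ fun t => ?_, fun z => ext (hL₁ _) fun t => ?_, fun z s => ?_⟩
  · rw [hL₁, hv₁, hu₁]
  · have ht0 : (0 : ℝ) ≤ t := t.2.1
    have ht1 : (t : ℝ) ≤ 1 := t.2.2
    rw [hL₂, hv₂]
    change glue H z (h 0 t) (r 0 t) = _
    rcases le_total (2 * (t : ℝ) - 1) 0 with ht | ht
    · have hr : r 0 t = 2 * t - 2 := by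
        simp only [r]; rw [max_eq_right (by linarith)]; ring
      have hh : h 0 t = 2 * t := by
        simp only [h]; rw [hr, min_eq_right (by linarith)]; ring
      rw [hr, hh, glue_of_nonpos (by linarith), glue_of_nonpos ht, hu₁, hK]
      congr 2
      rw [Set.projIcc_of_mem _ (⟨by linarith, by linarith⟩ : 2 * (t : ℝ) ∈ Set.Icc (0 : ℝ) 1),
        Set.projIcc_of_mem _ (⟨by linarith, by linarith⟩ : 1 - 2 * (t : ℝ) ∈ Set.Icc (0 : ℝ) 1)]
      exact Subtype.ext (by simp)
    · have hr : r 0 t = 4 * t - 3 := by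
        simp only [r]; rw [max_eq_left (by linarith)]; ring
      have hp := Set.projIcc_of_mem zero_le_one
        (⟨ht, by linarith⟩ : 2 * (t : ℝ) - 1 ∈ Set.Icc (0 : ℝ) 1)
      rw [glue_of_nonneg hK0 ht (fun _ => by linarith), hp, hu₂]
      change _ = glue H z (1 - 2 * (2 * t - 1)) (2 * (2 * t - 1) - 1)
      rw [show 2 * (2 * (t : ℝ) - 1) - 1 = r 0 t by rw [hr]; ring]
      rcases le_total (r 0 t) 0 with h0 | h0
      · have hh : h 0 t = 1 - 2 * (2 * t - 1) := by
          simp only [h]; rw [min_eq_left (by linarith), hr]; ring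
        rw [hh]
      · rw [glue_of_nonneg hH0 h0 (fun _ => (min_le_left _ _).trans (by linarith)),
          glue_of_nonneg hH0 h0 (fun _ => by linarith)]
  · have hr : r 1 t = t := by norm_num [r]
    rw [hL₂]
    change glue H z (h 1 t) (r 1 t) = z.1.2 t
    rw [glue_of_nonneg hH0 (t.2.1.trans_eq hr.symm) (fun _ => (min_le_left _ _).trans (by linarith)), hr,
      Set.projIcc_val]
  · have hr : r s 1 = 1 := by norm_num [r]
    change (L (z, s)).1.2 1 = z.1.2 1
    rw [hL₂]
    change glue H z (h s 1) (r s 1) = z.1.2 1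
    rw [hr, glue_of_nonneg hH0 zero_le_one (by norm_num), Set.projIcc_right]
    rfl

/-- The transport of the constant paths is homotopic to the canonical inclusion. -/
theorem homotopicMaps_transport_const (hH : Continuous H) (hH0 : ∀ x, H (x, 0) = f x)
    (hH1 : ∀ x, H (x, 1) = g x) {u : AssociatedSpace f → AssociatedSpace g}
    (hu₁ : ∀ z, (u z).1.1 = z.1.1)
    (hu₂ : ∀ z (t : I), (u z).1.2 t = glue H z (1 - 2 * t) (2 * t - 1)) :
    HomotopicMaps (fun x : X => u ⟨(x, ContinuousMap.const I (f x)), rfl⟩)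
      (fun x : X => (⟨(x, ContinuousMap.const I (g x)), rfl⟩ : AssociatedSpace g)) := by
  obtain ⟨L, hL, hL₁, hL₂⟩ := exists_continuous_lift (g := g)
    (fun p : X × I => p.1) (by fun_prop)
    (fun q => H (q.1.1, Set.projIcc 0 1 zero_le_one (max (1 - 2 * (q.2 : ℝ)) q.1.2)))
    (hH.comp ((by fun_prop : Continuous fun q : (X × I) × I => q.1.1).prodMk
      (continuous_projIcc.comp (by fun_prop))))
    (by
      rintro ⟨x, s⟩
      rw [Set.projIcc_of_right_le _ (le_max_of_le_left (by simp))]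
      exact hH1 x)
  refine ⟨L, hL, fun x => ext ?_ fun t => ?_, fun x => ext (hL₁ _) fun t => ?_⟩
  · rw [hL₁, hu₁]
  · rw [hL₂, hu₂]
    rcases le_total (2 * (t : ℝ) - 1) 0 with ht | ht
    · rw [glue_of_nonpos ht, max_eq_left (by change (0 : ℝ) ≤ _; linarith)]
    · have ht' : max (1 - 2 * (t : ℝ)) (0 : I) ≤ 0 := max_le (by linarith) le_rfl
      rw [glue_of_nonneg hH0 ht (fun _ => by linarith)]
      change H (x, Set.projIcc 0 1 zero_le_one (max (1 - 2 * (t : ℝ)) (0 : I))) = f x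
      rw [Set.projIcc_of_le_left _ ht']
      exact hH0 x
  · have ht : (1 : ℝ) ≤ max (1 - 2 * (t : ℝ)) (1 : I) := le_max_right _ _
    rw [hL₂]
    change H (x, Set.projIcc 0 1 zero_le_one (max (1 - 2 * (t : ℝ)) (1 : I))) = g x
    rw [Set.projIcc_of_right_le _ ht]
    exact hH1 x

end AssociatedSpace

/-- A homotopy `H` from `f` to `g` induces a map `ω_H : X^f → X^g` over `Y`
which is a fiber homotopy equivalence over `Y` and satisfies `ω_H ∘ λ_f ≃ λ_g`. -/
theorem homotopy_induces_fiberHomotopyEquiv_of_associated_fibrations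
    {X Y : Type} [TopologicalSpace X] [TopologicalSpace Y]
    (f g : X → Y) (hf : Continuous f) (hg : Continuous g)
    (H : X × I → Y) (hH : Continuous H)
    (hH0 : ∀ x, H (x, 0) = f x) (hH1 : ∀ x, H (x, 1) = g x) :
    ∃ ω : {xγ : X × C(I, Y) // xγ.2 0 = f xγ.1} → {xγ : X × C(I, Y) // xγ.2 0 = g xγ.1},
      (∀ z, (ω z).1.2 1 = z.1.2 1) ∧
      IsFiberHomotopyEquiv (fun z : {xγ : X × C(I, Y) // xγ.2 0 = f xγ.1} => z.1.2 1)
        (fun z : {xγ : X × C(I, Y) // xγ.2 0 = g xγ.1} => z.1.2 1) ω ∧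
      HomotopicMaps (fun x : X => ω ⟨(x, ContinuousMap.const I (f x)), rfl⟩)
        (fun x : X => (⟨(x, ContinuousMap.const I (g x)), rfl⟩ :
          {xγ : X × C(I, Y) // xγ.2 0 = g xγ.1})) := by
  have hK : Continuous fun p : X × I => H (p.1, σ p.2) := by fun_prop
  have hK0 (x : X) : H (x, σ 0) = g x := by rw [unitInterval.symm_zero, hH1]
  have hK1 (x : X) : H (x, σ 1) = f x := by rw [unitInterval.symm_one, hH0]
  obtain ⟨u, hu, hu₁, hu₂⟩ := AssociatedSpace.exists_transport hH hH0 hH1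
  obtain ⟨v, hv, hv₁, hv₂⟩ := AssociatedSpace.exists_transport hK hK0 hK1
  have hu_one := AssociatedSpace.transport_apply_one hH0 hu₂
  have hv_one := AssociatedSpace.transport_apply_one hK0 hv₂
  exact ⟨u, hu_one, ⟨hu, hu_one, v, hv, hv_one,
    AssociatedSpace.fiberHomotopic_transport_reverse hH hH0 hH1 (fun _ _ => rfl)
      hu₁ hu₂ hv₁ hv₂,
    AssociatedSpace.fiberHomotopic_transport_reverse hK hK0 hK1
      (fun _ _ => by rw [unitInterval.symm_symm]) hv₁ hv₂ hu₁ hu₂⟩,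
    AssociatedSpace.homotopicMaps_transport_const hH hH0 hH1 hu₁ hu₂⟩
end

section
/- Let p : E → B be a fibration, let f, g : X → E be continuous maps that are fiber homotopic over B (i.e. there is a homotopy from f to g through maps with the same composition with p, so in particular p ∘ f = p ∘ g), and let h : X × [0,1] → B be a homotopy with h(x,0) = p(f(x)). Let F, G : X × [0,1] → E be lifts of h with F(x,0) = f(x), G(x,0) = g(x), p ∘ F = h and p ∘ G = h. Then F and G are fiber homotopic over B: there exists a continuous Φ : X × [0,1] × [0,1] → E with Φ(x,t,0) = F(x,t), Φ(x,t,1) = G(x,t), and p(Φ(x,t,s)) = h(x,t) for all x, t, s. -/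
open unitInterval

/-- The map of the unit interval into itself obtained by clamping `s ↦ m * s + c`. -/
noncomputable def clampAffine (m c : ℝ) (s : I) : I :=
  Set.projIcc 0 1 zero_le_one (m * s + c)

lemma continuous_clampAffine (m c : ℝ) : Continuous (clampAffine m c) :=
  continuous_projIcc.comp (by fun_prop)

lemma clampAffine_eq_zero {m c : ℝ} {s : I} (h : m * s + c ≤ 0) : clampAffine m c s = 0 :=
  Set.projIcc_of_le_left _ h

lemma clampAffine_eq_one {m c : ℝ} {s : I} (h : 1 ≤ m * s + c) : clampAffine m c s = 1 :=
  Set.projIcc_of_right_le _ h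

/-- If `f, g : X → E` are fiber homotopic over `B` and `F, G` are lifts of the
same homotopy `h` starting at `f` resp. `g`, then `F` and `G` are fiber homotopic over `B`. -/
theorem lifts_of_fiber_homotopic_maps_fiber_homotopic
    {E B X : Type} [TopologicalSpace E] [TopologicalSpace B] [TopologicalSpace X]
    (p : E → B) (hpc : Continuous p) (hp : IsFibration p)
    (f g : X → E) (hf : Continuous f) (hg : Continuous g)
    (Lfg : X × I → E) (hLfg : Continuous Lfg)
    (hLfg0 : ∀ x, Lfg (x, 0) = f x) (hLfg1 : ∀ x, Lfg (x, 1) = g x)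
    (hLfgp : ∀ x s, p (Lfg (x, s)) = p (f x))
    (h : X × I → B) (hh : Continuous h) (hh0 : ∀ x, h (x, 0) = p (f x))
    (F G : X × I → E) (hF : Continuous F) (hG : Continuous G)
    (hF0 : ∀ x, F (x, 0) = f x) (hG0 : ∀ x, G (x, 0) = g x)
    (hFp : ∀ x t, p (F (x, t)) = h (x, t)) (hGp : ∀ x t, p (G (x, t)) = h (x, t)) :
    ∃ Φ : X × I × I → E, Continuous Φ ∧
      (∀ x t, Φ (x, t, 0) = F (x, t)) ∧
      (∀ x t, Φ (x, t, 1) = G (x, t)) ∧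
      ∀ x t s, p (Φ (x, t, s)) = h (x, t) := by
  have cont := continuous_clampAffine
  let c : I → I := fun s => clampAffine (-3) 1 s ⊔ clampAffine 3 (-2) s
  have hc : Continuous c := (cont _ _).sup (cont _ _)
  have c0 : c 0 = 1 := by
    simp [c, clampAffine_eq_one (m := -3) (c := 1) (s := 0) (by norm_num), unitInterval.le_one']
  have c1 : c 1 = 1 := by
    simp [c, clampAffine_eq_one (m := 3) (c := -2) (s := 1) (by norm_num), unitInterval.le_one']
  let g₀ : X × I × I → E := fun a =>
    if (a.2.2 : ℝ) ≤ 1 / 3 then F (a.1, a.2.1 * clampAffine (-3) 1 a.2.2)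
    else if (a.2.2 : ℝ) ≤ 2 / 3 then Lfg (a.1, clampAffine 3 (-1) a.2.2)
    else G (a.1, a.2.1 * clampAffine 3 (-2) a.2.2)
  have hg₀ : Continuous g₀ := by
    have hs : Continuous fun a : X × I × I => (a.2.2 : ℝ) := by fun_prop
    refine Continuous.if_le (by fun_prop) (Continuous.if_le (by fun_prop) (by fun_prop) hs
      continuous_const ?_) hs continuous_const ?_
    · intro a ha
      rw [clampAffine_eq_one (by rw [ha]; norm_num), clampAffine_eq_zero (by rw [ha]; norm_num),
        mul_zero, hLfg1, hG0]
    · intro a ha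
      rw [if_pos (by rw [ha]; norm_num), clampAffine_eq_zero (by rw [ha]; norm_num),
        clampAffine_eq_zero (by rw [ha]; norm_num), mul_zero, hLfg0, hF0]
  have hpg₀ : ∀ a, p (g₀ a) = h (a.1, a.2.1 * c a.2.2) := by
    rintro ⟨x, t, s⟩
    simp only [g₀, c]
    split_ifs with h1 h2
    · rw [hFp, clampAffine_eq_zero (m := 3) (c := -2) (by linarith), sup_of_le_left nonneg']
    · rw [hLfgp, clampAffine_eq_zero (m := -3) (by linarith),
        clampAffine_eq_zero (m := 3) (c := -2) (by linarith), sup_idem, mul_zero, hh0]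
    · rw [hGp, clampAffine_eq_zero (m := -3) (by linarith), sup_of_le_right nonneg']
  obtain ⟨K, hK, hK0, hKp⟩ := hp (X × I × I) inferInstance g₀
    (fun a => h (a.1.1, a.1.2.1 * Set.projIcc 0 1 zero_le_one ((c a.1.2.2 : ℝ) + a.2)))
    hg₀ (hh.comp (by
      have := continuous_projIcc (a := (0 : ℝ)) (b := 1) (h := zero_le_one)
      fun_prop)) (fun a => by simp [hpg₀])
  refine ⟨fun a => K (a, σ (c a.2.2)), by fun_prop, fun x t => ?_, fun x t => ?_,
    fun x t s => ?_⟩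
  · simp only [c0, symm_one, hK0, g₀]
    rw [if_pos (by norm_num), clampAffine_eq_one (by norm_num), mul_one]
  · simp only [c1, symm_one, hK0, g₀]
    rw [if_neg (by norm_num), if_neg (by norm_num), clampAffine_eq_one (by norm_num), mul_one]
  · rw [hKp]
    simp
end

section
/- Let p : E → B and p' : E' → B be fibrations and φ : E → E' a fiber homotopy equivalence over B. Let H : X × [0,1] → B be a homotopy from f to g (maps X → B), and let ω_H : f*E → g*E and ω'_H : f*E' → g*E' be fiber transports along H for p and p' respectively (arising from lifting solutions). Then the square commutes up to fiber homotopy over X: the maps ω'_H ∘ (f*φ) and (g*φ) ∘ ω_H from f*E to g*E' are fiber homotopic over X, where f*φ(x,e) = (x, φ(e)) and g*φ(x,e) = (x, φ(e)). -/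
open unitInterval

/-- Two lifts of the same homotopy through a fibration that start at the same map
end at maps which are homotopic through maps over the end of the homotopy. -/
theorem IsFibration.exists_homotopy_of_lifts {D E B : Type} [TopologicalSpace D]
    [TopologicalSpace E] [TopologicalSpace B] {p : E → B} (hp : IsFibration p)
    {G : D × I → B} (hG : Continuous G) {K₀ K₁ : D × I → E}
    (hK₀ : Continuous K₀) (hK₁ : Continuous K₁)
    (hpK₀ : ∀ z, p (K₀ z) = G z) (hpK₁ : ∀ z, p (K₁ z) = G z)
    (h0 : ∀ d, K₀ (d, 0) = K₁ (d, 0)) :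
    ∃ L : D × I → E, Continuous L ∧ (∀ d, L (d, 0) = K₀ (d, 1)) ∧
      (∀ d, L (d, 1) = K₁ (d, 1)) ∧ ∀ d t, p (L (d, t)) = G (d, 1) := by
  let P : ℝ → I := Set.projIcc 0 1 zero_le_one
  have hP : Continuous P := continuous_projIcc
  have P0 : ∀ {r : ℝ}, r ≤ 0 → P r = 0 := fun h => Set.projIcc_of_le_left zero_le_one h
  have P1 : ∀ {r : ℝ}, 1 ≤ r → P r = 1 := fun h => Set.projIcc_of_right_le zero_le_one h
  -- the path from `K₀ (d, 1)` back to the common start and then on to `K₁ (d, 1)`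
  let γ : D × I → E := fun z =>
    if (z.2 : ℝ) ≤ 1 / 2 then K₀ (z.1, P (1 - 2 * z.2)) else K₁ (z.1, P (2 * z.2 - 1))
  have hγ : Continuous γ := by
    refine Continuous.if_le (by fun_prop) (by fun_prop) (by fun_prop) (by fun_prop) ?_
    intro z hz
    rw [P0 (by linarith), P0 (by linarith), h0]
  -- a contraction of the image of this path in `B` onto its endpoint
  let Γ : (D × I) × I → B := fun w => G (w.1.1, P (max |1 - 2 * (w.1.2 : ℝ)| w.2))
  have hΓ : Continuous Γ := by fun_prop
  have hγΓ : ∀ z, Γ (z, 0) = p (γ z) := by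
    intro z
    have hmax : max |1 - 2 * (z.2 : ℝ)| ((0 : I) : ℝ) = |1 - 2 * (z.2 : ℝ)| :=
      max_eq_left (abs_nonneg _)
    simp only [Γ, γ, hmax]
    split_ifs with h
    · rw [hpK₀, abs_of_nonneg (by linarith)]
    · rw [hpK₁, abs_of_neg (by linarith), neg_sub]
  obtain ⟨M, hM, hM0, hpM⟩ := hp (D × I) inferInstance γ Γ hγ hΓ hγΓ
  -- traverse the three sides of the square over which `Γ` is constant
  refine ⟨fun z => M ((z.1, P (3 * z.2 - 1)), P (min (3 * z.2) (3 - 3 * z.2))),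
    by fun_prop, fun d => ?_, fun d => ?_, fun d t => ?_⟩
  · have h₁ : P (3 * ((0 : I) : ℝ) - 1) = 0 := P0 (by norm_num)
    have h₂ : P (min (3 * ((0 : I) : ℝ)) (3 - 3 * ((0 : I) : ℝ))) = 0 := P0 (by norm_num)
    have h₃ : P (1 - 2 * ((0 : I) : ℝ)) = 1 := P1 (by norm_num)
    simp only [h₁, h₂, hM0, γ, h₃]
    exact if_pos (by norm_num)
  · have h₁ : P (3 * ((1 : I) : ℝ) - 1) = 1 := P1 (by norm_num)
    have h₂ : P (min (3 * ((1 : I) : ℝ)) (3 - 3 * ((1 : I) : ℝ))) = 0 := P0 (by norm_num)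
    have h₃ : P (2 * ((1 : I) : ℝ) - 1) = 1 := P1 (by norm_num)
    simp only [h₁, h₂, hM0, γ, h₃]
    exact if_neg (by norm_num)
  · simp only [hpM, Γ]
    congr 2
    apply P1
    rcases le_total (3 * (t : ℝ)) 1 with h | h
    · rw [P0 (by linarith)]
      exact le_max_of_le_left (by norm_num)
    · rcases le_total 2 (3 * (t : ℝ)) with h' | h'
      · rw [P1 (r := 3 * (t : ℝ) - 1) (by linarith)]
        exact le_max_of_le_left (by norm_num)
      · rw [P1 (r := min _ _) (le_min h (by linarith))]
        exact le_max_of_le_right (by norm_num)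

/-- For a fiber homotopy equivalence `φ : E → E'` over `B` between fibrations
and a homotopy `H` from `f` to `g`, the square formed by the fiber transports `ω_H`, `ω'_H` and
the pulled-back maps `f*φ`, `g*φ` commutes up to fiber homotopy over `X`. -/
theorem fiber_transport_commutes_with_fiberHomotopyEquiv
    {E E' B X : Type} [TopologicalSpace E] [TopologicalSpace E'] [TopologicalSpace B]
    [TopologicalSpace X]
    (p : E → B) (p' : E' → B) (hpc : Continuous p) (hp'c : Continuous p')
    (hp : IsFibration p) (hp' : IsFibration p')
    (φ : E → E') (hφc : Continuous φ) (hφp : ∀ e, p' (φ e) = p e)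
    (ψ : E' → E) (hψc : Continuous ψ) (hψp : ∀ e', p (ψ e') = p' e')
    (hψφ : FiberHomotopic p p (fun e => ψ (φ e)) id)
    (hφψ : FiberHomotopic p' p' (fun e' => φ (ψ e')) id)
    (f g : X → B) (hf : Continuous f) (hg : Continuous g)
    (H : X × I → B) (hH : Continuous H)
    (hH0 : ∀ x, H (x, 0) = f x) (hH1 : ∀ x, H (x, 1) = g x)
    -- a lifting solution for `p` along `H` and its fiber transport `ω : f*E → g*E`
    (H' : {xe : X × E // f xe.1 = p xe.2} × I → E)
    (hH'c : Continuous H') (hH'0 : ∀ z, H' (z, 0) = z.1.2)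
    (hH'p : ∀ z t, p (H' (z, t)) = H (z.1.1, t))
    (ω : {xe : X × E // f xe.1 = p xe.2} → {xe : X × E // g xe.1 = p xe.2})
    (hω : ∀ z, (ω z).1 = (z.1.1, H' (z, 1)))
    -- a lifting solution for `p'` along `H` and its fiber transport `ω' : f*E' → g*E'`
    (H'' : {xe : X × E' // f xe.1 = p' xe.2} × I → E')
    (hH''c : Continuous H'') (hH''0 : ∀ z, H'' (z, 0) = z.1.2)
    (hH''p : ∀ z t, p' (H'' (z, t)) = H (z.1.1, t))
    (ω' : {xe : X × E' // f xe.1 = p' xe.2} → {xe : X × E' // g xe.1 = p' xe.2})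
    (hω' : ∀ z, (ω' z).1 = (z.1.1, H'' (z, 1)))
    -- the pulled-back maps `f*φ : f*E → f*E'` and `g*φ : g*E → g*E'`
    (Fφ : {xe : X × E // f xe.1 = p xe.2} → {xe : X × E' // f xe.1 = p' xe.2})
    (hFφ : ∀ z, (Fφ z).1 = (z.1.1, φ z.1.2))
    (Gφ : {xe : X × E // g xe.1 = p xe.2} → {xe : X × E' // g xe.1 = p' xe.2})
    (hGφ : ∀ z, (Gφ z).1 = (z.1.1, φ z.1.2)) :
    FiberHomotopic (fun z : {xe : X × E // f xe.1 = p xe.2} => z.1.1)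
      (fun z : {xe : X × E' // g xe.1 = p' xe.2} => z.1.1)
      (fun z => ω' (Fφ z)) (fun z => Gφ (ω z)) := by
  have hFφc : Continuous Fφ := by
    refine continuous_induced_rng.2 ?_
    rw [show Subtype.val ∘ Fφ = fun z => (z.1.1, φ z.1.2) from funext hFφ]
    fun_prop
  have hF1 : ∀ z, (Fφ z).1.1 = z.1.1 := fun z => congrArg Prod.fst (hFφ z)
  have hF2 : ∀ z, (Fφ z).1.2 = φ z.1.2 := fun z => congrArg Prod.snd (hFφ z)
  obtain ⟨L, hL, hL0, hL1, hpL⟩ := hp'.exists_homotopy_of_lifts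
    (G := fun z : {xe : X × E // f xe.1 = p xe.2} × I => H (z.1.1.1, z.2)) (by fun_prop)
    (K₀ := fun z => H'' (Fφ z.1, z.2)) (K₁ := fun z => φ (H' z)) (by fun_prop) (by fun_prop)
    (fun z => by rw [hH''p, hF1]) (fun z => by rw [hφp, hH'p])
    (fun d => by rw [hH''0, hF2, hH'0])
  refine ⟨fun z => ⟨(z.1.1.1, L z), by rw [hpL, hH1]⟩, by fun_prop, fun d => ?_, fun d => ?_,
    fun d t => rfl⟩
  · refine Subtype.ext ?_
    rw [hω', hF1]
    exact congrArg (Prod.mk d.1.1) (hL0 d)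
  · refine Subtype.ext ?_
    rw [hGφ, hω]
    exact congrArg (Prod.mk d.1.1) (hL1 d)
end

section
/- Let p : E → B and p' : E' → B be fibrations, let φ : E → E' be a fiber homotopy equivalence over B, let b₀ ∈ B and let γ : [0,1] → B be a loop at b₀. Write F = p⁻¹(b₀) and F' = (p')⁻¹(b₀), and let ω_γ : F → F and ω'_γ : F' → F' be transports along γ for p and p' respectively. Then ω'_γ ∘ (φ|_F) and (φ|_F) ∘ ω_γ are homotopic as maps F → F' (where φ|_F : F → F' is the restriction of φ). -/
open unitInterval

open Set in
/-- Two lifts of the same homotopy with the same start end in vertically homotopic maps. -/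
theorem IsFibration.exists_homotopy_of_lifts_s14 {A E B : Type} [TopologicalSpace A]
    [TopologicalSpace E] [TopologicalSpace B] {p : E → B} (hpc : Continuous p)
    (hp : IsFibration p) {h₀ h₁ : A × I → E} (hc₀ : Continuous h₀) (hc₁ : Continuous h₁)
    (hstart : ∀ a, h₀ (a, 0) = h₁ (a, 0)) (hproj : ∀ x, p (h₀ x) = p (h₁ x)) :
    ∃ H : A × I → E, Continuous H ∧ (∀ a, H (a, 0) = h₀ (a, 1)) ∧
      (∀ a, H (a, 1) = h₁ (a, 1)) ∧ ∀ a r, p (H (a, r)) = p (h₀ (a, 1)) := by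
  let c : ℝ → I := projIcc 0 1 zero_le_one
  have hc : Continuous c := continuous_projIcc
  have c_zero : c 0 = 0 := projIcc_left zero_le_one
  have c_of_nonpos {x : ℝ} (hx : x ≤ 0) : c x = 0 := projIcc_of_le_left _ hx
  have c_of_one_le {x : ℝ} (hx : 1 ≤ x) : c x = 1 := projIcc_of_right_le _ hx
  -- the reverse of `h₀` followed by `h₁`
  let k : A × I → E := fun x =>
    if (x.2 : ℝ) ≤ 1 / 2 then h₀ (x.1, c (1 - 2 * x.2)) else h₁ (x.1, c (2 * x.2 - 1))
  have hk : Continuous k := by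
    refine Continuous.if_le (by fun_prop) (by fun_prop) (by fun_prop) (by fun_prop) ?_
    intro x hx
    rw [hx]
    norm_num [c_zero, hstart]
  have hpk (x : A × I) : p (k x) = p (h₀ (x.1, c |2 * x.2 - 1|)) := by
    by_cases hx : (x.2 : ℝ) ≤ 1 / 2
    · simp only [k, if_pos hx]
      rw [abs_of_nonpos (by linarith), neg_sub]
    · simp only [k, if_neg hx]
      rw [abs_of_nonneg (by linarith), hproj]
  obtain ⟨M, hM, hM0, hMp⟩ := hp (A × I) inferInstance k
    (fun x => p (h₀ (x.1.1, c |2 * x.1.2 - 1| ⊔ x.2))) hk (by fun_prop)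
    (fun x => by simp only [hpk, sup_eq_left.2 unitInterval.nonneg'])
  refine ⟨
    -- restrict `M` to three sides of the square `I × I`
    fun x => M ((x.1, c (3 * x.2 - 1)), c (min (3 * x.2) (3 - 3 * x.2))), by fun_prop,
    fun a => ?_, fun a => ?_, fun a r => ?_⟩
  · have h₁ : c (3 * (0 : I) - 1) = 0 := c_of_nonpos (by norm_num)
    have h₂ : c (min (3 * (0 : I)) (3 - 3 * (0 : I))) = 0 := c_of_nonpos (by norm_num)
    simp only [h₁, h₂, hM0, k]
    norm_num [c_of_one_le]
  · have h₁ : c (3 * (1 : I) - 1) = 1 := c_of_one_le (by norm_num)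
    have h₂ : c (min (3 * (1 : I)) (3 - 3 * (1 : I))) = 0 := c_of_nonpos (by norm_num)
    simp only [h₁, h₂, hM0, k]
    norm_num [c_of_one_le]
  · rw [hMp]
    suffices h : c |2 * (c (3 * r - 1) : ℝ) - 1| ⊔ c (min (3 * r) (3 - 3 * r)) = 1 by
      simp only [h]
    rcases le_total (3 * (r : ℝ)) 1 with hr | hr
    · rw [c_of_nonpos (by linarith : 3 * (r : ℝ) - 1 ≤ 0), c_of_one_le (by norm_num)]
      exact sup_eq_left.2 (le_one _)
    rcases le_total 2 (3 * (r : ℝ)) with hr' | hr'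
    · rw [c_of_one_le (by linarith : 1 ≤ 3 * (r : ℝ) - 1), c_of_one_le (by norm_num)]
      exact sup_eq_left.2 (le_one _)
    · rw [c_of_one_le (le_min hr (by linarith))]
      exact sup_eq_right.2 (le_one _)

/-- For a fiber homotopy equivalence `φ : E → E'` over `B` between fibrations
and a loop `γ` at `b₀`, the transports `ω_γ`, `ω'_γ` along `γ` in `E` and `E'` satisfy
`ω'_γ ∘ φ|F ≃ φ|F ∘ ω_γ` as maps `F → F'` between the fibers over `b₀`. -/
theorem transport_conjugation_by_fiberHomotopyEquiv
    {E E' B : Type} [TopologicalSpace E] [TopologicalSpace E'] [TopologicalSpace B]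
    (p : E → B) (p' : E' → B) (hpc : Continuous p) (hp'c : Continuous p')
    (hp : IsFibration p) (hp' : IsFibration p')
    (φ : E → E') (hφc : Continuous φ) (hφp : ∀ e, p' (φ e) = p e)
    (ψ : E' → E) (hψc : Continuous ψ) (hψp : ∀ e', p (ψ e') = p' e')
    (hψφ : FiberHomotopic p p (fun e => ψ (φ e)) id)
    (hφψ : FiberHomotopic p' p' (fun e' => φ (ψ e')) id)
    (b₀ : B) (γ : I → B) (hγ : Continuous γ) (hγ0 : γ 0 = b₀) (hγ1 : γ 1 = b₀)
    -- a transport along `γ` in `E`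
    (K : {e : E // p e = b₀} × I → E) (hKc : Continuous K)
    (hK0 : ∀ e, K (e, 0) = e.1) (hKp : ∀ e t, p (K (e, t)) = γ t)
    (ω : {e : E // p e = b₀} → {e : E // p e = b₀})
    (hω : ∀ e, (ω e).1 = K (e, 1))
    -- a transport along `γ` in `E'`
    (K' : {e : E' // p' e = b₀} × I → E') (hK'c : Continuous K')
    (hK'0 : ∀ e, K' (e, 0) = e.1) (hK'p : ∀ e t, p' (K' (e, t)) = γ t)
    (ω' : {e : E' // p' e = b₀} → {e : E' // p' e = b₀})
    (hω' : ∀ e, (ω' e).1 = K' (e, 1))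
    -- the restriction `φ|F : F → F'`
    (φF : {e : E // p e = b₀} → {e : E' // p' e = b₀})
    (hφF : ∀ e, (φF e).1 = φ e.1) :
    HomotopicMaps (fun e => ω' (φF e)) (fun e => φF (ω e)) := by
  have hφF' : Continuous φF :=
    continuous_induced_rng.2 ((hφc.comp continuous_subtype_val).congr fun e => (hφF e).symm)
  obtain ⟨H, hH, hH0, hH1, hHp⟩ := hp'.exists_homotopy_of_lifts_s14 hp'c
    (h₀ := fun x => K' (φF x.1, x.2)) (h₁ := fun x => φ (K x)) (by fun_prop) (by fun_prop)
    (fun e => by rw [hK'0, hK0, hφF]) (fun x => by rw [hK'p, hφp, hKp])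
  have hHb (x) : p' (H x) = b₀ := by rw [hHp, hK'p, hγ1]
  refine ⟨fun x => ⟨H x, hHb x⟩, hH.subtype_mk hHb, fun e => ?_, fun e => ?_⟩
  · exact Subtype.ext ((hH0 e).trans (hω' _).symm)
  · exact Subtype.ext ((hH1 e).trans (by rw [hφF, hω]))
end

section
/- Let M be a topological space, f : M → S¹ continuous, where S¹ = ℝ/ℤ with quotient map π : ℝ → S¹. Let X = {(r,m) ∈ ℝ × M | π(r) = f(m)} and f̄ : X → ℝ, (r,m) ↦ r. Let M^f = {(m,δ) ∈ M × C([0,1],S¹) | δ(0) = f(m)} with p_f(m,δ) = δ(1), and let X^{f̄} = {((r,m),γ) ∈ X × C([0,1],ℝ) | γ(0) = r} with p_{f̄}((r,m),γ) = γ(1). Define u : X^{f̄} → M^f by u((r,m),γ) = (m, π∘γ). Then the map X^{f̄} → {(s,e) ∈ ℝ × M^f | π(s) = p_f(e)}, z ↦ (p_{f̄}(z), u(z)), is a homeomorphism; that is, X^{f̄} together with p_{f̄} and u is the pullback of p_f : M^f → S¹ along π : ℝ → S¹. -/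
open unitInterval

/-- The unit-speed projection `ℝ → ℝ/ℤ` has continuous path lifting with prescribed endpoint:
a family of paths in the circle, with continuously chosen lifts of their endpoints, lifts to a
continuous family of paths in `ℝ`. -/
theorem AddCircle.exists_continuous_lift_of_endpoint {A : Type*} [TopologicalSpace A]
    (δ : C(A, C(I, AddCircle (1 : ℝ)))) (s : C(A, ℝ))
    (hs : ∀ a, ((s a : ℝ) : AddCircle (1 : ℝ)) = δ a 1) :
    ∃ Γ : C(A, C(I, ℝ)), (∀ a, Γ a 1 = s a) ∧
      ∀ a t, ((Γ a t : ℝ) : AddCircle (1 : ℝ)) = δ a t := by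
  let H : C(I × A, AddCircle (1 : ℝ)) :=
    ⟨fun x => δ x.2 (unitInterval.symm x.1), by fun_prop⟩
  have H_zero : ∀ a, H (0, a) = ((s a : ℝ) : AddCircle (1 : ℝ)) := by
    intro a
    simp [H, hs]
  have cov := AddCircle.isCoveringMap_coe (1 : ℝ)
  obtain ⟨L, L_zero, L_lifts⟩ : ∃ L : C(I × A, ℝ), (∀ a, L (0, a) = s a) ∧
      ∀ x, ((L x : ℝ) : AddCircle (1 : ℝ)) = H x :=
    ⟨cov.liftHomotopy H s H_zero, cov.liftHomotopy_zero H s H_zero,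
      congrFun (cov.liftHomotopy_lifts H s H_zero)⟩
  let Γ : C(A × I, ℝ) := ⟨fun x => L (unitInterval.symm x.2, x.1), by fun_prop⟩
  refine ⟨Γ.curry, fun a => ?_, fun a t => ?_⟩
  · simpa [Γ] using L_zero a
  · simpa [Γ, H] using L_lifts (unitInterval.symm t, a)

/-- Paths in `ℝ` with the same projection to the circle and the same endpoint are equal. -/
theorem AddCircle.path_lift_ext {γ γ' : C(I, ℝ)} (h₁ : γ 1 = γ' 1)
    (h : ∀ t, ((γ t : ℝ) : AddCircle (1 : ℝ)) = γ' t) : γ = γ' :=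
  DFunLike.coe_injective <| (AddCircle.isCoveringMap_coe (1 : ℝ)).eq_of_comp_eq
    γ.continuous γ'.continuous (funext h) 1 h₁

/-- For `f : M → S¹` with pullback `X = {(r,m) | π r = f m}` along
`π : ℝ → S¹`, the total space `X^f̄` of the fibration associated to `f̄ : X → ℝ`, together with
`p_f̄` and the map `u : X^f̄ → M^f`, `((r,m),γ) ↦ (m, π ∘ γ)`, is the pullback of
`p_f : M^f → S¹` along `π`: the induced map `z ↦ (p_f̄ z, u z)` is a homeomorphism onto
`{(s,e) ∈ ℝ × M^f | π s = p_f e}`. -/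
theorem associated_fibration_pullback_homeomorph
    {M : Type} [TopologicalSpace M] (f : M → AddCircle (1 : ℝ)) (hf : Continuous f)
    (piC : C(ℝ, AddCircle (1 : ℝ))) (hpi : ∀ r : ℝ, piC r = (r : AddCircle (1 : ℝ)))
    (u : {xγ : {rm : ℝ × M // ((rm.1 : AddCircle (1 : ℝ))) = f rm.2} × C(I, ℝ) //
          xγ.2 0 = xγ.1.1.1}
        → {mδ : M × C(I, AddCircle (1 : ℝ)) // mδ.2 0 = f mδ.1})
    (hu : ∀ z, (u z).1 = (z.1.1.1.2, piC.comp z.1.2))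
    (Φ : {xγ : {rm : ℝ × M // ((rm.1 : AddCircle (1 : ℝ))) = f rm.2} × C(I, ℝ) //
          xγ.2 0 = xγ.1.1.1}
        → {se : ℝ × {mδ : M × C(I, AddCircle (1 : ℝ)) // mδ.2 0 = f mδ.1} //
          ((se.1 : AddCircle (1 : ℝ))) = se.2.1.2 1})
    (hΦ : ∀ z, (Φ z).1 = (z.1.2 1, u z)) :
    IsHomeomorph Φ := by
  have u_continuous : Continuous u := by
    refine continuous_induced_rng.2 ?_
    simp only [Function.comp_def, hu]
    fun_prop
  have Φ_continuous : Continuous Φ := by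
    refine continuous_induced_rng.2 ?_
    simp only [Function.comp_def, hΦ]
    fun_prop
  have Φ_fst (z) : (Φ z).1.1 = z.1.2 1 := by rw [hΦ]
  have Φ_base (z) : (Φ z).1.2.1.1 = z.1.1.1.2 := by rw [hΦ, hu]
  have Φ_path (z) : (Φ z).1.2.1.2 = piC.comp z.1.2 := by rw [hΦ, hu]
  obtain ⟨Γ, Γ_one, Γ_lift⟩ := AddCircle.exists_continuous_lift_of_endpoint
    (A := {se : ℝ × {mδ : M × C(I, AddCircle (1 : ℝ)) // mδ.2 0 = f mδ.1} //
      ((se.1 : AddCircle (1 : ℝ))) = se.2.1.2 1})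
    ⟨fun w => w.1.2.1.2, by fun_prop⟩ ⟨fun w => w.1.1, by fun_prop⟩ (fun w => w.2)
  simp only [ContinuousMap.coe_mk] at Γ_one Γ_lift
  refine isHomeomorph_iff_exists_inverse.2 ⟨Φ_continuous,
    fun w => ⟨(⟨(Γ w 0, w.1.2.1.1), (Γ_lift w 0).trans w.1.2.2⟩, Γ w), rfl⟩, ?_, ?_, ?_⟩
  · intro z
    have key : Γ (Φ z) = z.1.2 := by
      refine AddCircle.path_lift_ext ((Γ_one _).trans (Φ_fst z)) fun t => ?_
      rw [Γ_lift, Φ_path, ContinuousMap.comp_apply, hpi]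
    refine Subtype.ext (Prod.ext (Subtype.ext (Prod.ext ?_ (Φ_base z))) key)
    exact (congrArg (fun γ : C(I, ℝ) => γ 0) key).trans z.2
  · intro w
    refine Subtype.ext (Prod.ext ((Φ_fst _).trans (Γ_one w))
      (Subtype.ext (Prod.ext (Φ_base _) ((Φ_path _).trans ?_))))
    ext t
    exact (hpi _).trans (Γ_lift w t)
  · fun_prop
end
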